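/- In the clipping ANN setting, the risk function L : ℝ^{h+1} → ℝ is twice continuously differentiable, and for every θ = (θ_1, …, θ_{h+1}) ∈ ℝ^{h+1} it holds that (i) for all i, j ∈ {1, …, h}: (∂²/∂θ_i ∂θ_j L)(θ) = 2 v_i v_j ∫_{I_i^θ ∩ I_j^θ} p(x) dx − 2 (v_i/w_i) 1_{{i}}(j) [ (N^θ(ψ_i(θ) + 1/w_i) − f(ψ_i(θ) + 1/w_i)) p(ψ_i(θ) + 1/w_i) − (N^θ(ψ_i(θ)) − f(ψ_i(θ))) p(ψ_i(θ)) ], (ii) for all i ∈ {1, …, h}: (∂²/∂θ_i ∂θ_{h+1} L)(θ) = 2 v_i ∫_{I_i^θ} p(x) dx, and (iii) (∂²/∂θ_{h+1}² L)(θ) = 2 ∫_a^b p(x) dx. -/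

import Mathlib

open MeasureTheory Filter

noncomputable section

/-- The clipping function `x ↦ min{max{x,0},1}`. -/
def clipFn (x : ℝ) : ℝ := min (max x 0) 1

/-- `ψ_i(θ) = -θ_i / w_i`. -/
def psiC {h : ℕ} (w : Fin h → ℝ) (θ : Fin (h + 1) → ℝ) (i : Fin h) : ℝ :=
  -θ i.castSucc / w i

/-- The activity interval `I_i^θ = (ψ_i(θ), ψ_i(θ) + 1/w_i) ∩ (a, b)`. -/
def actI {h : ℕ} (a b : ℝ) (w : Fin h → ℝ) (θ : Fin (h + 1) → ℝ) (i : Fin h) : Set ℝ :=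
  Set.Ioo (psiC w θ i) (psiC w θ i + (w i)⁻¹) ∩ Set.Ioo a b

/-- The realization function `N^θ(x) = θ_{h+1} + ∑_i v_i c(w_i x + θ_i)`. -/
def realC {h : ℕ} (v w : Fin h → ℝ) (θ : Fin (h + 1) → ℝ) (x : ℝ) : ℝ :=
  θ (Fin.last h) + ∑ i : Fin h, v i * clipFn (w i * x + θ i.castSucc)

/-- The risk `L(θ) = ∫_a^b (N^θ(x) - f(x))² p(x) dx`. -/
def riskC {h : ℕ} (a b : ℝ) (v w : Fin h → ℝ) (f p : ℝ → ℝ) (θ : Fin (h + 1) → ℝ) : ℝ :=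
  ∫ x in Set.Ioo a b, (realC v w θ x - f x) ^ 2 * p x

/-- The gradient `∇L(θ)` as a vector of partial derivatives. -/
def gradC {h : ℕ} (a b : ℝ) (v w : Fin h → ℝ) (f p : ℝ → ℝ) (θ : Fin (h + 1) → ℝ) :
    Fin (h + 1) → ℝ :=
  fun k => fderiv ℝ (riskC a b v w f p) θ (Pi.single k 1)

/-- `x` is a descending critical point of `g` : `∇g(x) = 0` and the Hessian quadratic form
admits a negative value. -/
def IsDescCrit {n : ℕ} (g : (Fin n → ℝ) → ℝ) (x : Fin n → ℝ) : Prop :=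
  fderiv ℝ g x = 0 ∧ ∃ u : Fin n → ℝ, iteratedFDeriv ℝ 2 g x ![u, u] < 0

/-- The Euclidean norm on `Fin n → ℝ`. -/
def euclNorm {n : ℕ} (x : Fin n → ℝ) : ℝ := Real.sqrt (∑ i, (x i) ^ 2)

/-- Piecewise polynomial functions. -/
def PiecewisePoly (F : ℝ → ℝ) : Prop :=
  ∃ (K : ℕ) (τ : ℕ → EReal), 0 < K ∧ τ 0 = ⊥ ∧ τ K = ⊤ ∧
    (∀ k, k < K → τ k < τ (k + 1)) ∧
    ∀ k, k < K → ∃ q : Polynomial ℝ, ∀ x : ℝ,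
      τ k < (x : EReal) → (x : EReal) < τ (k + 1) → F x = q.eval x

open scoped Topology

/-- The almost everywhere derivative of `clipFn`. -/
def clipDeriv (u : ℝ) : ℝ := (Set.Ioo (0 : ℝ) 1).indicator (fun _ => 1) u

/-- The partial differential of `realC` in `θ`, away from the kinks. -/
def realCDeriv {h : ℕ} (v w : Fin h → ℝ) (θ : Fin (h + 1) → ℝ) (x : ℝ) :
    (Fin (h + 1) → ℝ) →L[ℝ] ℝ :=
  ContinuousLinearMap.proj (Fin.last h) +
    ∑ i : Fin h, (v i * clipDeriv (w i * x + θ i.castSucc)) •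
      ContinuousLinearMap.proj (R := ℝ) (φ := fun _ => ℝ) i.castSucc

/-- The primitive, based at `a`, of the weighted residual `(N^θ - f) p`. -/
def residualPrim {h : ℕ} (a : ℝ) (v w : Fin h → ℝ) (f p : ℝ → ℝ) (θ : Fin (h + 1) → ℝ)
    (y : ℝ) : ℝ :=
  ∫ x in a..y, (realC v w θ x - f x) * p x

lemma continuous_clipFn : Continuous clipFn := by
  unfold clipFn; fun_prop

lemma abs_clipFn_sub_le (x y : ℝ) : |clipFn x - clipFn y| ≤ |x - y| := by
  refine (abs_min_sub_min_le_max _ _ _ _).trans ?_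
  simpa using abs_max_sub_max_le_abs x y 0

lemma clipFn_eventuallyEq {u : ℝ} (h0 : u ≠ 0) (h1 : u ≠ 1) :
    (∃ c, clipFn =ᶠ[𝓝 u] (fun _ => c) ∧ clipDeriv =ᶠ[𝓝 u] fun _ => 0) ∨
      (clipFn =ᶠ[𝓝 u] id ∧ clipDeriv =ᶠ[𝓝 u] fun _ => 1) := by
  rcases lt_or_gt_of_ne h0 with h | h
  · refine Or.inl ⟨0, ?_, ?_⟩ <;> filter_upwards [Iio_mem_nhds h] with x (hx : x < 0)
    · simp [clipFn, hx.le]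
    · simp [clipDeriv, hx.le]
  rcases lt_or_gt_of_ne h1 with h' | h'
  · refine Or.inr ⟨?_, ?_⟩ <;> filter_upwards [Ioo_mem_nhds h h'] with x hx
    · simp [clipFn, hx.1.le, hx.2.le]
    · simp [clipDeriv, hx.1, hx.2]
  · refine Or.inl ⟨1, ?_, ?_⟩ <;> filter_upwards [Ioi_mem_nhds h'] with x (hx : 1 < x)
    · simp [clipFn, hx.le]
    · simp [clipDeriv, hx.le]

lemma hasDerivAt_clipFn {u : ℝ} (h0 : u ≠ 0) (h1 : u ≠ 1) :
    HasDerivAt clipFn (clipDeriv u) u := by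
  rcases clipFn_eventuallyEq h0 h1 with ⟨c, hc, hd⟩ | ⟨hc, hd⟩
  · rw [hd.self_of_nhds]; exact (hasDerivAt_const u c).congr_of_eventuallyEq hc
  · rw [hd.self_of_nhds]; exact (hasDerivAt_id u).congr_of_eventuallyEq hc

lemma continuousAt_clipDeriv {u : ℝ} (h0 : u ≠ 0) (h1 : u ≠ 1) : ContinuousAt clipDeriv u := by
  rcases clipFn_eventuallyEq h0 h1 with ⟨-, -, hd⟩ | ⟨-, hd⟩ <;>
    exact continuousAt_const.congr hd.symm

lemma measurable_clipDeriv : Measurable clipDeriv :=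
  measurable_const.indicator measurableSet_Ioo

lemma abs_clipDeriv_le (u : ℝ) : |clipDeriv u| ≤ 1 := by
  unfold clipDeriv Set.indicator; split_ifs <;> simp

variable {h : ℕ} {v w : Fin h → ℝ} {f p : ℝ → ℝ}

lemma ae_ne_kink (hw : ∀ i, 0 < w i) (θ : Fin (h + 1) → ℝ) :
    ∀ᵐ x : ℝ, ∀ i, w i * x + θ i.castSucc ≠ 0 ∧ w i * x + θ i.castSucc ≠ 1 := by
  refine ae_all_iff.2 fun i => ?_
  have hwi := (hw i).ne'
  filter_upwards [volume.ae_ne (-θ i.castSucc / w i),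
    volume.ae_ne ((1 - θ i.castSucc) / w i)] with x h0 h1
  constructor
  · intro hx; apply h0; field_simp; linarith
  · intro hx; apply h1; field_simp; linarith

lemma continuous_realC (v w : Fin h → ℝ) :
    Continuous fun q : (Fin (h + 1) → ℝ) × ℝ => realC v w q.1 q.2 := by
  have := continuous_clipFn
  unfold realC; fun_prop

lemma continuous_realC_right (v w : Fin h → ℝ) (θ : Fin (h + 1) → ℝ) :
    Continuous (realC v w θ) :=
  (continuous_realC v w).comp (Continuous.prodMk_right θ)

lemma abs_realC_sub_le (hv : ∀ i, 0 < v i) (θ η : Fin (h + 1) → ℝ) (x : ℝ) :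
    |realC v w θ x - realC v w η x| ≤ (1 + ∑ i, v i) * ‖θ - η‖ := by
  have hcoord (k) : |θ k - η k| ≤ ‖θ - η‖ := norm_le_pi_norm (θ - η) k
  have heq : realC v w θ x - realC v w η x = (θ (Fin.last h) - η (Fin.last h)) +
      ∑ i, v i * (clipFn (w i * x + θ i.castSucc) - clipFn (w i * x + η i.castSucc)) := by
    simp only [realC, mul_sub, Finset.sum_sub_distrib]; ring
  rw [heq, add_mul, one_mul, Finset.sum_mul]
  refine (abs_add_le _ _).trans (add_le_add (hcoord _)
    ((Finset.abs_sum_le_sum_abs _ _).trans (Finset.sum_le_sum fun i _ => ?_)))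
  rw [abs_mul, abs_of_pos (hv i)]
  refine mul_le_mul_of_nonneg_left ((abs_clipFn_sub_le _ _).trans ?_) (hv i).le
  simpa using hcoord i.castSucc

lemma hasFDerivAt_realC {θ : Fin (h + 1) → ℝ} {x : ℝ}
    (hx : ∀ i, w i * x + θ i.castSucc ≠ 0 ∧ w i * x + θ i.castSucc ≠ 1) :
    HasFDerivAt (fun η => realC v w η x) (realCDeriv v w θ x) θ := by
  refine (ContinuousLinearMap.hasFDerivAt
    (ContinuousLinearMap.proj (R := ℝ) (φ := fun _ => ℝ) (Fin.last h))).add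
      (HasFDerivAt.fun_sum fun i _ => ?_)
  rw [mul_smul]
  exact ((hasDerivAt_clipFn (hx i).1 (hx i).2).comp_hasFDerivAt θ
    ((ContinuousLinearMap.hasFDerivAt
      (ContinuousLinearMap.proj (R := ℝ) (φ := fun _ => ℝ) i.castSucc)).const_add _)).const_mul
      (v i)

lemma continuousAt_realCDeriv {θ : Fin (h + 1) → ℝ} {x : ℝ}
    (hx : ∀ i, w i * x + θ i.castSucc ≠ 0 ∧ w i * x + θ i.castSucc ≠ 1) :
    ContinuousAt (fun η => realCDeriv v w η x) θ := by
  have hclip (i : Fin h) :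
      ContinuousAt (fun η : Fin (h + 1) → ℝ => clipDeriv (w i * x + η i.castSucc)) θ :=
    ContinuousAt.comp (f := fun η : Fin (h + 1) → ℝ => w i * x + η i.castSucc)
      (continuousAt_clipDeriv (hx i).1 (hx i).2)
      (continuous_const.add (continuous_apply i.castSucc)).continuousAt
  unfold realCDeriv
  fun_prop

lemma stronglyMeasurable_realCDeriv (v w : Fin h → ℝ) (θ : Fin (h + 1) → ℝ) :
    StronglyMeasurable (realCDeriv v w θ) := by
  refine stronglyMeasurable_const.add
    (Finset.stronglyMeasurable_fun_sum _ fun i _ => StronglyMeasurable.smul_const ?_ _)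
  exact ((measurable_clipDeriv.comp (by fun_prop)).const_mul _).stronglyMeasurable

lemma norm_realCDeriv_le (hv : ∀ i, 0 < v i) (θ : Fin (h + 1) → ℝ) (x : ℝ) :
    ‖realCDeriv v w θ x‖ ≤ 1 + ∑ i, v i := by
  have hproj (k : Fin (h + 1)) :
      ‖ContinuousLinearMap.proj (R := ℝ) (φ := fun _ : Fin (h + 1) => ℝ) k‖ ≤ 1 :=
    ContinuousLinearMap.opNorm_le_bound _ zero_le_one fun y => by
      simpa using norm_le_pi_norm y k
  refine (norm_add_le _ _).trans (add_le_add (hproj _)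
    ((norm_sum_le _ _).trans (Finset.sum_le_sum fun i _ => ?_)))
  rw [norm_smul, Real.norm_eq_abs, abs_mul, abs_of_pos (hv i), mul_assoc]
  exact mul_le_of_le_one_right (hv i).le
    (mul_le_one₀ (abs_clipDeriv_le _) (norm_nonneg _) (hproj _))

/-- `x ↦ g x • ∂_θ N^θ(x)` is integrable on bounded intervals. -/
lemma intervalIntegrable_smul_realCDeriv (hv : ∀ i, 0 < v i) {g : ℝ → ℝ} (hg : Continuous g)
    (θ : Fin (h + 1) → ℝ) (α β : ℝ) :
    IntervalIntegrable (fun x => g x • realCDeriv v w θ x) volume α β := by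
  refine ((hg.norm.mul_const (1 + ∑ i, v i)).intervalIntegrable α β).mono_fun
    (hg.stronglyMeasurable.smul (stronglyMeasurable_realCDeriv v w θ)).aestronglyMeasurable
    (ae_of_all _ fun x => ?_)
  simp only [norm_smul, norm_mul, norm_norm]
  exact mul_le_mul_of_nonneg_left ((norm_realCDeriv_le hv θ x).trans (le_abs_self _))
    (norm_nonneg _)

lemma intervalIntegrable_mul_clipDeriv {g : ℝ → ℝ} (hg : Continuous g) (c s α β : ℝ) :
    IntervalIntegrable (fun x => g x * clipDeriv (c * x + s)) volume α β := by
  refine (hg.intervalIntegrable α β).mono_fun (hg.stronglyMeasurable.mul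
    (measurable_clipDeriv.comp (by fun_prop)).stronglyMeasurable).aestronglyMeasurable
    (ae_of_all _ fun x => ?_)
  simp only [norm_mul]
  exact mul_le_of_le_one_right (norm_nonneg _) (abs_clipDeriv_le _)

lemma integral_smul_realCDeriv {g : ℝ → ℝ} (hg : Continuous g)
    (θ : Fin (h + 1) → ℝ) (α β : ℝ) :
    ∫ x in α..β, g x • realCDeriv v w θ x =
      (∫ x in α..β, g x) • ContinuousLinearMap.proj (R := ℝ) (φ := fun _ => ℝ) (Fin.last h) +
      ∑ i : Fin h, (v i * ∫ x in α..β, g x * clipDeriv (w i * x + θ i.castSucc)) •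
        ContinuousLinearMap.proj (R := ℝ) (φ := fun _ => ℝ) i.castSucc := by
  have h_integrable (i : Fin h) : IntervalIntegrable (fun x =>
      (v i * (g x * clipDeriv (w i * x + θ i.castSucc))) •
        ContinuousLinearMap.proj (R := ℝ) (φ := fun _ : Fin (h + 1) => ℝ) i.castSucc)
      volume α β :=
    ⟨((intervalIntegrable_mul_clipDeriv hg _ _ α β).const_mul _).1.smul_const _,
      ((intervalIntegrable_mul_clipDeriv hg _ _ α β).const_mul _).2.smul_const _⟩
  have hlast : IntervalIntegrable (fun x => g x •
      ContinuousLinearMap.proj (R := ℝ) (φ := fun _ : Fin (h + 1) => ℝ) (Fin.last h))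
      volume α β := (hg.smul continuous_const).intervalIntegrable α β
  have heq (x : ℝ) : g x • realCDeriv v w θ x =
      g x • ContinuousLinearMap.proj (R := ℝ) (φ := fun _ => ℝ) (Fin.last h) +
      ∑ i : Fin h, (v i * (g x * clipDeriv (w i * x + θ i.castSucc))) •
        ContinuousLinearMap.proj (R := ℝ) (φ := fun _ => ℝ) i.castSucc := by
    simp only [realCDeriv, smul_add, Finset.smul_sum, smul_smul]
    congr 1
    exact Finset.sum_congr rfl fun i _ => by rw [mul_left_comm]
  simp only [heq]
  rw [intervalIntegral.integral_add hlast (by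
      simpa only [Finset.sum_fn] using IntervalIntegrable.sum Finset.univ fun i _ => h_integrable i),
    intervalIntegral.integral_finsetSum fun i _ => h_integrable i]
  simp only [intervalIntegral.integral_smul_const, intervalIntegral.integral_const_mul]

lemma integral_mul_clipDeriv {c s : ℝ} (hc : 0 < c) (g : ℝ → ℝ) {α β : ℝ} (hαβ : α ≤ β) :
    ∫ x in α..β, g x * clipDeriv (c * x + s) =
      ∫ x in Set.Ioo α β ∩ Set.Ioo (-s / c) (-s / c + c⁻¹), g x := by
  have hind : (fun x => g x * clipDeriv (c * x + s)) =
      (Set.Ioo (-s / c) (-s / c + c⁻¹)).indicator g := by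
    have hmem (x : ℝ) : c * x + s ∈ Set.Ioo (0 : ℝ) 1 ↔
        x ∈ Set.Ioo (-s / c) (-s / c + c⁻¹) := by
      rw [Set.mem_Ioo, Set.mem_Ioo, div_lt_iff₀ hc, inv_eq_one_div, ← add_div, lt_div_iff₀ hc]
      constructor <;> rintro ⟨_, _⟩ <;> constructor <;> linarith
    ext x
    by_cases hx : x ∈ Set.Ioo (-s / c) (-s / c + c⁻¹)
    · rw [Set.indicator_of_mem hx, clipDeriv, Set.indicator_of_mem ((hmem x).2 hx), mul_one]
    · rw [Set.indicator_of_notMem hx, clipDeriv, Set.indicator_of_notMem (mt (hmem x).1 hx),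
        mul_zero]
  rw [intervalIntegral.integral_of_le hαβ, integral_Ioc_eq_integral_Ioo, hind,
    setIntegral_indicator measurableSet_Ioo]

lemma setIntegral_inter_support {g : ℝ → ℝ} {s t : Set ℝ} (hs : MeasurableSet s)
    (hg : ∀ x ∉ t, g x = 0) : ∫ x in s ∩ t, g x = ∫ x in s, g x :=
  (setIntegral_eq_of_subset_of_forall_sdiff_eq_zero hs Set.inter_subset_left
    fun x hx => hg x fun hxt => hx.2 ⟨hx.1, hxt⟩).symm

lemma continuous_residual (hf : Continuous f) (hp : Continuous p) (θ : Fin (h + 1) → ℝ) :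
    Continuous fun x => (realC v w θ x - f x) * p x :=
  ((continuous_realC_right v w θ).sub hf).mul hp

lemma hasFDerivAt_residualPrim_left (hv : ∀ i, 0 < v i) (hw : ∀ i, 0 < w i)
    (hf : Continuous f) (hp : Continuous p) (a y : ℝ) (θ : Fin (h + 1) → ℝ) :
    HasFDerivAt (fun η => residualPrim a v w f p η y)
      (∫ x in a..y, p x • realCDeriv v w θ x) θ := by
  refine (intervalIntegral.hasFDerivAt_integral_of_dominated_loc_of_lip
    (bound := fun x => |p x| * (1 + ∑ i, v i)) univ_mem
    (Eventually.of_forall fun η => (continuous_residual hf hp η).aestronglyMeasurable)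
    ((continuous_residual hf hp θ).intervalIntegrable a y)
    (hp.stronglyMeasurable.smul (stronglyMeasurable_realCDeriv v w θ)).aestronglyMeasurable
    (ae_of_all _ fun x _ => LipschitzOnWith.of_dist_le_mul fun η _ ζ _ => ?_)
    ((hp.abs.mul_const _).intervalIntegrable a y) ?_).2
  · rw [Real.dist_eq, dist_eq_norm, Real.coe_nnabs, ← sub_mul, sub_sub_sub_cancel_right, abs_mul,
      mul_comm, abs_mul, abs_abs, mul_assoc]
    gcongr
    exact (abs_realC_sub_le hv η ζ x).trans (by gcongr; exact le_abs_self _)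
  · filter_upwards [ae_ne_kink hw θ] with x hx _
    exact ((hasFDerivAt_realC hx).sub_const _).mul_const (p x)

lemma continuous_integral_smul_realCDeriv (hv : ∀ i, 0 < v i) (hw : ∀ i, 0 < w i)
    (hp : Continuous p) (a : ℝ) :
    Continuous fun q : (Fin (h + 1) → ℝ) × ℝ => ∫ x in a..q.2, p x • realCDeriv v w q.1 x := by
  refine continuous_iff_continuousAt.2 fun ⟨θ, y⟩ => ?_
  refine intervalIntegral.continuousAt_parametric_primitive_of_dominated
    (F := fun η x => p x • realCDeriv v w η x) (fun x => |p x| * (1 + ∑ i, v i))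
    (min a y - 1) (max a y + 1)
    (fun η =>
      (hp.stronglyMeasurable.smul (stronglyMeasurable_realCDeriv v w η)).aestronglyMeasurable)
    (Eventually.of_forall fun η => ae_of_all _ fun x => ?_)
    ((hp.abs.mul_const _).intervalIntegrable _ _) (ae_restrict_of_ae ?_)
    ⟨by linarith [min_le_left a y], by linarith [le_max_left a y]⟩
    ⟨by linarith [min_le_right a y], by linarith [le_max_right a y]⟩ (by simp)
  · rw [norm_smul, Real.norm_eq_abs]
    gcongr
    exact norm_realCDeriv_le hv η x
  · filter_upwards [ae_ne_kink hw θ] with x hx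
    exact (continuousAt_realCDeriv hx).const_smul (p x)

/-- The joint differential of `residualPrim` in `(θ, y)`. -/
def residualPrimDeriv (a : ℝ) (v w : Fin h → ℝ) (f p : ℝ → ℝ) (q : (Fin (h + 1) → ℝ) × ℝ) :
    ((Fin (h + 1) → ℝ) × ℝ) →L[ℝ] ℝ :=
  (∫ x in a..q.2, p x • realCDeriv v w q.1 x).coprod
    (ContinuousLinearMap.toSpanSingleton ℝ ((realC v w q.1 q.2 - f q.2) * p q.2))

lemma continuous_toSpanSingleton_residual (v w : Fin h → ℝ) (hf : Continuous f)
    (hp : Continuous p) :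
    Continuous fun q : (Fin (h + 1) → ℝ) × ℝ =>
      ContinuousLinearMap.toSpanSingleton ℝ ((realC v w q.1 q.2 - f q.2) * p q.2) := by
  have := continuous_realC v w
  exact (ContinuousLinearMap.toSpanSingletonCLE (𝕜 := ℝ) (E := ℝ)).continuous.comp (by fun_prop)

lemma hasFDerivAt_residualPrim (hv : ∀ i, 0 < v i) (hw : ∀ i, 0 < w i)
    (hf : Continuous f) (hp : Continuous p) (a : ℝ) (q : (Fin (h + 1) → ℝ) × ℝ) :
    HasFDerivAt (fun q : (Fin (h + 1) → ℝ) × ℝ => residualPrim a v w f p q.1 q.2)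
      (residualPrimDeriv a v w f p q) q :=
  (hasStrictFDerivAt_uncurry_coprod
    (f := residualPrim a v w f p)
    (f₁ := fun θ y => ∫ x in a..y, p x • realCDeriv v w θ x)
    (f₂ := fun θ y => ContinuousLinearMap.toSpanSingleton ℝ ((realC v w θ y - f y) * p y))
    (Eventually.of_forall fun r => hasFDerivAt_residualPrim_left hv hw hf hp a r.2 r.1)
    (Eventually.of_forall fun r =>
      ((continuous_residual hf hp r.1).integral_hasStrictDerivAt a r.2).hasDerivAt.hasFDerivAt)
    (continuous_integral_smul_realCDeriv hv hw hp a).continuousAt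
    (continuous_toSpanSingleton_residual v w hf hp).continuousAt).hasFDerivAt

lemma contDiff_residualPrim (hv : ∀ i, 0 < v i) (hw : ∀ i, 0 < w i)
    (hf : Continuous f) (hp : Continuous p) (a : ℝ) :
    ContDiff ℝ 1 fun q : (Fin (h + 1) → ℝ) × ℝ => residualPrim a v w f p q.1 q.2 := by
  refine contDiff_one_iff_hasFDerivAt.2
    ⟨residualPrimDeriv a v w f p, ?_, hasFDerivAt_residualPrim hv hw hf hp a⟩
  exact (ContinuousLinearMap.coprodEquivL (𝕜 := ℝ) ℝ).continuous.comp
    ((continuous_integral_smul_realCDeriv hv hw hp a).prodMk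
      (continuous_toSpanSingleton_residual v w hf hp))

lemma integral_smul_realCDeriv_single_last {g : ℝ → ℝ} (hg : Continuous g)
    (θ : Fin (h + 1) → ℝ) (α β : ℝ) :
    (∫ x in α..β, g x • realCDeriv v w θ x) (Pi.single (Fin.last h) 1) = ∫ x in α..β, g x := by
  simp [integral_smul_realCDeriv hg, Fin.castSucc_ne_last]

lemma integral_smul_realCDeriv_single_castSucc {g : ℝ → ℝ} (hg : Continuous g)
    (θ : Fin (h + 1) → ℝ) (α β : ℝ) (i : Fin h) :
    (∫ x in α..β, g x • realCDeriv v w θ x) (Pi.single i.castSucc 1) =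
      v i * ∫ x in α..β, g x * clipDeriv (w i * x + θ i.castSucc) := by
  simp [integral_smul_realCDeriv hg, Pi.single_apply, (Fin.castSucc_ne_last i).symm]

/-- The differential of the risk. -/
def riskCDeriv {h : ℕ} (a b : ℝ) (v w : Fin h → ℝ) (f p : ℝ → ℝ) (θ : Fin (h + 1) → ℝ) :
    (Fin (h + 1) → ℝ) →L[ℝ] ℝ :=
  (2 * residualPrim a v w f p θ b) •
      ContinuousLinearMap.proj (R := ℝ) (φ := fun _ => ℝ) (Fin.last h) +
    ∑ i : Fin h, (2 * v i * (residualPrim a v w f p θ (psiC w θ i + (w i)⁻¹) -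
        residualPrim a v w f p θ (psiC w θ i))) •
      ContinuousLinearMap.proj (R := ℝ) (φ := fun _ => ℝ) i.castSucc

lemma riskCDeriv_single_last (a b : ℝ) (θ : Fin (h + 1) → ℝ) :
    riskCDeriv a b v w f p θ (Pi.single (Fin.last h) 1) = 2 * residualPrim a v w f p θ b := by
  simp [riskCDeriv, Fin.castSucc_ne_last]

lemma riskCDeriv_single_castSucc (a b : ℝ) (θ : Fin (h + 1) → ℝ) (i : Fin h) :
    riskCDeriv a b v w f p θ (Pi.single i.castSucc 1) =
      2 * v i * (residualPrim a v w f p θ (psiC w θ i + (w i)⁻¹) -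
        residualPrim a v w f p θ (psiC w θ i)) := by
  simp [riskCDeriv, Pi.single_apply, (Fin.castSucc_ne_last i).symm]

lemma residualPrim_sub (hf : Continuous f) (hp : Continuous p) (a : ℝ) (θ : Fin (h + 1) → ℝ)
    (y z : ℝ) :
    residualPrim a v w f p θ z - residualPrim a v w f p θ y =
      ∫ x in y..z, (realC v w θ x - f x) * p x :=
  intervalIntegral.integral_interval_sub_left
    ((continuous_residual hf hp θ).intervalIntegrable _ _)
    ((continuous_residual hf hp θ).intervalIntegrable _ _)

lemma integral_residual_smul_realCDeriv (hw : ∀ i, 0 < w i) (hf : Continuous f)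
    (hp : Continuous p) {a b : ℝ} (hab : a ≤ b) (hsupp : ∀ x ∉ Set.Ioo a b, p x = 0)
    (θ : Fin (h + 1) → ℝ) :
    ∫ x in a..b, (2 * ((realC v w θ x - f x) * p x)) • realCDeriv v w θ x =
      riskCDeriv a b v w f p θ := by
  rw [integral_smul_realCDeriv ((continuous_residual hf hp θ).const_mul 2), riskCDeriv]
  congr 1
  · rw [intervalIntegral.integral_const_mul, residualPrim]
  refine Finset.sum_congr rfl fun i _ => ?_
  congr 1
  have hle : psiC w θ i ≤ psiC w θ i + (w i)⁻¹ :=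
    le_add_of_nonneg_right (inv_nonneg.2 (hw i).le)
  simp only [mul_assoc (2 : ℝ)]
  rw [residualPrim_sub hf hp, intervalIntegral.integral_const_mul,
    integral_mul_clipDeriv (hw i) _ hab,
    Set.inter_comm, setIntegral_inter_support measurableSet_Ioo fun x hx => by
      rw [hsupp x hx, mul_zero],
    intervalIntegral.integral_of_le hle, integral_Ioc_eq_integral_Ioo]
  exact mul_left_comm _ _ _

lemma hasFDerivAt_riskC (hv : ∀ i, 0 < v i) (hw : ∀ i, 0 < w i) (hf : Continuous f)
    (hp : Continuous p) {a b : ℝ} (hab : a ≤ b) (hsupp : ∀ x ∉ Set.Ioo a b, p x = 0)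
    (θ : Fin (h + 1) → ℝ) :
    HasFDerivAt (riskC a b v w f p) (riskCDeriv a b v w f p θ) θ := by
  have h_integrable {g : ℝ → ℝ} (hg : Continuous g) : Integrable g (volume.restrict (Set.Ioo a b)) :=
    (hg.integrableOn_Icc (a := a) (b := b)).mono_set Set.Ioo_subset_Icc_self
  have hN := continuous_realC_right v w
  have hC : 0 ≤ 1 + ∑ i, v i :=
    add_nonneg zero_le_one (Finset.sum_nonneg fun i _ => (hv i).le)
  have hderiv := (hasFDerivAt_integral_of_dominated_loc_of_lip'
    (μ := volume.restrict (Set.Ioo a b))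
    (F := fun η x => (realC v w η x - f x) ^ 2 * p x)
    (F' := fun x => (2 * ((realC v w θ x - f x) * p x)) • realCDeriv v w θ x)
    (bound := fun x => (1 + ∑ i, v i) *
      ((2 * |realC v w θ x - f x| + (1 + ∑ i, v i)) * |p x|))
    (Metric.ball_mem_nhds θ one_pos)
    (fun η _ => ((((hN η).sub hf).pow 2).mul hp).aestronglyMeasurable)
    (h_integrable ((((hN θ).sub hf).pow 2).mul hp))
    (((continuous_residual hf hp θ).const_mul 2).stronglyMeasurable.smul
      (stronglyMeasurable_realCDeriv v w θ)).aestronglyMeasurable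
    (ae_of_all _ fun x η hη => ?_)
    (h_integrable (by have := hN θ; fun_prop))
    (ae_restrict_of_ae ?_)).2
  · rwa [← integral_Ioc_eq_integral_Ioo, ← intervalIntegral.integral_of_le hab,
      integral_residual_smul_realCDeriv hw hf hp hab hsupp] at hderiv
  · have hlip := abs_realC_sub_le (w := w) hv η θ x
    have hball : ‖η - θ‖ ≤ 1 := (mem_ball_iff_norm.1 hη).le
    have hsum : |(realC v w η x - f x) + (realC v w θ x - f x)| ≤
        2 * |realC v w θ x - f x| + (1 + ∑ i, v i) := by
      have heq : (realC v w η x - f x) + (realC v w θ x - f x) =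
        2 * (realC v w θ x - f x) + (realC v w η x - realC v w θ x) := by ring
      rw [heq]
      refine (abs_add_le _ _).trans (add_le_add (by rw [abs_mul, abs_two]) ?_)
      exact hlip.trans (mul_le_of_le_one_right hC hball)
    have heq : (realC v w η x - f x) ^ 2 * p x - (realC v w θ x - f x) ^ 2 * p x =
        (realC v w η x - realC v w θ x) *
          ((realC v w η x - f x) + (realC v w θ x - f x)) * p x := by ring
    rw [heq, Real.norm_eq_abs, abs_mul, abs_mul]
    calc _ ≤ ((1 + ∑ i, v i) * ‖η - θ‖) *
          (2 * |realC v w θ x - f x| + (1 + ∑ i, v i)) * |p x| := by gcongr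
      _ = _ := by ring
  · filter_upwards [ae_ne_kink hw θ] with x hx
    refine ((((hasFDerivAt_realC hx).sub_const (f x)).pow 2).mul_const (p x)).congr_fderiv ?_
    ext u
    simp
    ring

lemma hasFDerivAt_residualPrim_psiC (hv : ∀ i, 0 < v i) (hw : ∀ i, 0 < w i)
    (hf : Continuous f) (hp : Continuous p) (a c : ℝ) (j : Fin h) (θ : Fin (h + 1) → ℝ) :
    HasFDerivAt (fun η => residualPrim a v w f p η (psiC w η j + c))
      ((∫ x in a..(psiC w θ j + c), p x • realCDeriv v w θ x) -
        ((realC v w θ (psiC w θ j + c) - f (psiC w θ j + c)) * p (psiC w θ j + c) / w j) •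
          ContinuousLinearMap.proj (R := ℝ) (φ := fun _ => ℝ) j.castSucc) θ := by
  have hpsi : HasFDerivAt (fun η : Fin (h + 1) → ℝ => psiC w η j + c)
      (-(w j)⁻¹ • ContinuousLinearMap.proj (R := ℝ) (φ := fun _ => ℝ) j.castSucc) θ := by
    have := ((ContinuousLinearMap.hasFDerivAt (x := θ)
      (-(w j)⁻¹ • ContinuousLinearMap.proj (R := ℝ) (φ := fun _ => ℝ) j.castSucc))).add_const c
    refine this.congr_of_eventuallyEq (Eventually.of_forall fun η => ?_)
    simp [psiC, div_eq_inv_mul]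
  refine ((hasFDerivAt_residualPrim hv hw hf hp a (θ, psiC w θ j + c)).comp θ
    ((hasFDerivAt_id θ).prodMk hpsi)).congr_fderiv ?_
  ext u
  simp [residualPrimDeriv]
  ring

lemma contDiff_riskCDeriv (hv : ∀ i, 0 < v i) (hw : ∀ i, 0 < w i)
    (hf : Continuous f) (hp : Continuous p) (a b : ℝ) :
    ContDiff ℝ 1 (riskCDeriv a b v w f p) := by
  have hprim {y : (Fin (h + 1) → ℝ) → ℝ} (hy : ContDiff ℝ 1 y) :
      ContDiff ℝ 1 fun θ => residualPrim a v w f p θ (y θ) :=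
    (contDiff_residualPrim hv hw hf hp a).comp (contDiff_id.prodMk hy)
  have hpsi (i : Fin h) : ContDiff ℝ 1 fun θ : Fin (h + 1) → ℝ => psiC w θ i := by
    unfold psiC; fun_prop
  refine ((contDiff_const.mul (hprim contDiff_const)).smul contDiff_const).add
    (ContDiff.sum fun i _ => (contDiff_const.mul ((hprim ((hpsi i).add contDiff_const)).sub
      (hprim (hpsi i)))).smul contDiff_const)

lemma iteratedFDeriv_two_riskC (hv : ∀ i, 0 < v i) (hw : ∀ i, 0 < w i) (hf : Continuous f)
    (hp : Continuous p) {a b : ℝ} (hab : a ≤ b) (hsupp : ∀ x ∉ Set.Ioo a b, p x = 0)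
    {θ u z : Fin (h + 1) → ℝ} {A : (Fin (h + 1) → ℝ) →L[ℝ] ℝ}
    (hA : HasFDerivAt (fun η => riskCDeriv a b v w f p η z) A θ) :
    iteratedFDeriv ℝ 2 (riskC a b v w f p) θ ![u, z] = A u := by
  have hfd : fderiv ℝ (riskC a b v w f p) = riskCDeriv a b v w f p :=
    funext fun η => (hasFDerivAt_riskC hv hw hf hp hab hsupp η).fderiv
  have hd := ((contDiff_riskCDeriv hv hw hf hp a b).differentiable one_ne_zero θ).hasFDerivAt
  rw [iteratedFDeriv_two_apply, hfd, hA.unique (hd.clm_apply (hasFDerivAt_const z θ))]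
  simp

theorem statement_3
    (a b : ℝ) (hab : a < b) (h : ℕ) (hh : 0 < h)
    (v w : Fin h → ℝ) (hv : ∀ i, 0 < v i) (hw : ∀ i, 0 < w i)
    (f p : ℝ → ℝ) (hf : Continuous f) (hp : Continuous p)
    (hpnn : ∀ x : ℝ, 0 ≤ p x) (hsupp : {x : ℝ | 0 < p x} = Set.Ioo a b) :
    ContDiff ℝ 2 (riskC a b v w f p) ∧
    (∀ θ : Fin (h + 1) → ℝ, ∀ i j : Fin h,
      iteratedFDeriv ℝ 2 (riskC a b v w f p) θ
          ![Pi.single i.castSucc 1, Pi.single j.castSucc 1]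
        = 2 * v i * v j * (∫ x in actI a b w θ i ∩ actI a b w θ j, p x)
          - 2 * (v i / w i) * (if j = i then (1 : ℝ) else 0) *
            ((realC v w θ (psiC w θ i + (w i)⁻¹) - f (psiC w θ i + (w i)⁻¹))
                * p (psiC w θ i + (w i)⁻¹)
              - (realC v w θ (psiC w θ i) - f (psiC w θ i)) * p (psiC w θ i))) ∧
    (∀ θ : Fin (h + 1) → ℝ, ∀ i : Fin h,
      iteratedFDeriv ℝ 2 (riskC a b v w f p) θ
          ![Pi.single i.castSucc 1, Pi.single (Fin.last h) 1]
        = 2 * v i * ∫ x in actI a b w θ i, p x) ∧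
    (∀ θ : Fin (h + 1) → ℝ,
      iteratedFDeriv ℝ 2 (riskC a b v w f p) θ
          ![Pi.single (Fin.last h) 1, Pi.single (Fin.last h) 1]
        = 2 * ∫ x in Set.Ioo a b, p x) := by
  have hzero : ∀ x ∉ Set.Ioo a b, p x = 0 := fun x hx =>
    ((hpnn x).antisymm (not_lt.1 fun hpx => hx (hsupp ▸ hpx))).symm
  have hlast (θ : Fin (h + 1) → ℝ) : HasFDerivAt
      (fun η => riskCDeriv a b v w f p η (Pi.single (Fin.last h) 1))
      ((2 : ℝ) • ∫ x in a..b, p x • realCDeriv v w θ x) θ := by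
    simp only [riskCDeriv_single_last]
    exact (hasFDerivAt_residualPrim_left hv hw hf hp a b θ).const_mul 2
  refine ⟨?_, fun θ i j => ?_, fun θ i => ?_, fun θ => ?_⟩
  · rw [← one_add_one_eq_two]
    exact contDiff_succ_iff_hasFDerivAt.2 ⟨riskCDeriv a b v w f p,
      contDiff_riskCDeriv hv hw hf hp a b, hasFDerivAt_riskC hv hw hf hp hab.le hzero⟩
  · have hright := hasFDerivAt_residualPrim_psiC hv hw hf hp a (w j)⁻¹ j θ
    have hleft := hasFDerivAt_residualPrim_psiC hv hw hf hp a 0 j θ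
    simp only [add_zero] at hleft
    have hj := ((hright.sub hleft).const_mul (2 * v j)).congr_of_eventuallyEq
      (Eventually.of_forall fun η => riskCDeriv_single_castSucc a b η j)
    have hle : psiC w θ j ≤ psiC w θ j + (w j)⁻¹ :=
      le_add_of_nonneg_right (inv_nonneg.2 (hw j).le)
    have hcross : (∫ x in a..(psiC w θ j + (w j)⁻¹), p x • realCDeriv v w θ x)
          (Pi.single i.castSucc 1) -
        (∫ x in a..(psiC w θ j), p x • realCDeriv v w θ x) (Pi.single i.castSucc 1) =
        v i * ∫ x in actI a b w θ i ∩ actI a b w θ j, p x := by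
      have hset : actI a b w θ i ∩ actI a b w θ j =
          (Set.Ioo (psiC w θ j) (psiC w θ j + (w j)⁻¹) ∩
            Set.Ioo (psiC w θ i) (psiC w θ i + (w i)⁻¹)) ∩ Set.Ioo a b := by
        unfold actI
        rw [← Set.inter_inter_distrib_right, Set.inter_comm (Set.Ioo (psiC w θ i) _)]
      refine (DFunLike.congr_fun (intervalIntegral.integral_interval_sub_left
        (intervalIntegrable_smul_realCDeriv hv hp θ _ _)
        (intervalIntegrable_smul_realCDeriv hv hp θ _ _)) (Pi.single i.castSucc 1)).trans ?_
      rw [integral_smul_realCDeriv_single_castSucc hp, integral_mul_clipDeriv (hw i) p hle, hset,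
        setIntegral_inter_support (measurableSet_Ioo.inter measurableSet_Ioo) hzero]
      rfl
    rw [iteratedFDeriv_two_riskC hv hw hf hp hab.le hzero hj]
    simp only [smul_apply, sub_apply, smul_eq_mul,
      ContinuousLinearMap.proj_apply]
    rw [sub_sub_sub_comm, hcross]
    by_cases hij : j = i
    · subst hij
      simp
      ring
    · simp [hij]
      ring
  · rw [iteratedFDeriv_two_riskC hv hw hf hp hab.le hzero (hlast θ),
      smul_apply, integral_smul_realCDeriv_single_castSucc hp,
      integral_mul_clipDeriv (hw i) p hab.le, Set.inter_comm, smul_eq_mul, mul_assoc]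
    rfl
  · rw [iteratedFDeriv_two_riskC hv hw hf hp hab.le hzero (hlast θ),
      smul_apply, integral_smul_realCDeriv_single_last hp,
      intervalIntegral.integral_of_le hab.le, integral_Ioc_eq_integral_Ioo, smul_eq_mul]
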